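/- Let k be a field of characteristic zero. Every unipotent (i.e. conilpotent) commutative and cocommutative Hopf algebra H over k is generated by its primitive elements, and the canonical map Sym(P(H)) → H from the symmetric algebra on the space P(H) of primitives is an isomorphism of Hopf algebras, where Sym(P(H)) carries the Hopf structure with P(H) primitive. -/

import Mathlib

open TensorProduct

section Defs

variable (k : Type) [CommRing k]

/-- The submodule of primitive elements of a Hopf (or bi-) algebra:
`x` with `Δ x = x ⊗ 1 + 1 ⊗ x`. -/
def Primitives (H : Type) [Ring H] [Bialgebra k H] : Submodule k H where
  carrier := {x | Coalgebra.comul (R := k) x = x ⊗ₜ[k] (1 : H) + (1 : H) ⊗ₜ[k] x}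
  zero_mem' := by simp
  add_mem' := by
    intro a b ha hb
    simp only [Set.mem_setOf_eq] at ha hb ⊢
    rw [map_add, ha, hb, add_tmul, tmul_add]
    abel
  smul_mem' := by
    intro c x hx
    simp only [Set.mem_setOf_eq] at hx ⊢
    rw [map_smul, hx, smul_add, smul_tmul', tmul_smul, smul_tmul']

/-- `(S, ι)` is a symmetric algebra on the `k`-module `V` if it satisfies the universal
property: linear maps `V → R` into commutative `k`-algebras extend uniquely to algebra
homomorphisms `S → R`. -/
def IsSymAlg {V S : Type} [AddCommGroup V] [Module k V] [CommRing S] [Algebra k S]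
    (ι : V →ₗ[k] S) : Prop :=
  ∀ (R : Type) [CommRing R] [Algebra k R] (f : V →ₗ[k] R),
    ∃! g : S →ₐ[k] R, ∀ v : V, g (ι v) = f v

variable {k}

/-- Iterated tensor powers `H, H ⊗ H, H ⊗ (H ⊗ H), …` as bundled modules. -/
noncomputable def TpowM (H : ModuleCat k) : ℕ → ModuleCat k
  | 0 => H
  | n + 1 => ModuleCat.of k (TensorProduct k H (TpowM H n))

variable {H : Type} [Ring H] [Bialgebra k H]

/-- The `n`-fold iterated comultiplication `H → H^{⊗(n+1)}`. -/
noncomputable def iterComul : ∀ n : ℕ, H →ₗ[k] (TpowM (ModuleCat.of k H) n)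
  | 0 => LinearMap.id
  | n + 1 =>
      (LinearMap.lTensor H (iterComul n)).comp (Coalgebra.comul (R := k) (A := H))

/-- The projection `π : H → H`, `x ↦ x - ε(x) 1`, onto the augmentation coideal. -/
noncomputable def piAug : H →ₗ[k] H :=
  LinearMap.id - (Algebra.linearMap k H).comp (Coalgebra.counit (R := k) (A := H))

/-- The map applying `π` to each tensor factor of `H^{⊗(n+1)}`. -/
noncomputable def piPow : ∀ n : ℕ,
    (TpowM (ModuleCat.of k H) n) →ₗ[k] (TpowM (ModuleCat.of k H) n)
  | 0 => (piAug : H →ₗ[k] H)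
  | n + 1 => TensorProduct.map (piAug : H →ₗ[k] H) (piPow n)

/-- A bialgebra is conilpotent (unipotent) if every element is killed by some iterated
reduced comultiplication: for each `x` there is `n` with `π^{⊗(n+1)} (Δ⁽ⁿ⁾ x) = 0`. -/
def IsConilpotent (k : Type) [CommRing k] (H : Type) [Ring H] [Bialgebra k H] : Prop :=
  ∀ x : H, ∃ n : ℕ, piPow (k := k) n (iterComul n x) = 0

end Defs

namespace MM
open Polynomial WithConv Coalgebra

section uniq
variable {k : Type} [Field k] [CharZero k] {B : Type} [CommRing B] [Algebra k B]

lemma poly_zero (k : Type) [Field k] [CharZero k] {B : Type} [CommRing B] [Algebra k B]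
    (p : B[X]) (h : ∀ n : ℕ, p.eval (n : B) = 0) : p = 0 := by
  ext i
  rw [coeff_zero]
  rw [← Module.forall_dual_apply_eq_zero_iff k]
  intro φ
  let q : k[X] := ∑ j ∈ Finset.range (p.natDegree + 1), C (φ (p.coeff j)) * X ^ j
  have hq : q = 0 := by
    apply Polynomial.eq_zero_of_infinite_isRoot
    apply Set.Infinite.mono (s := Set.range (fun n : ℕ => (n : k)))
    · rintro _ ⟨n, rfl⟩
      have h1 := congrArg φ (h n)
      rw [eval_eq_sum_range, map_sum, map_zero] at h1
      simp only [Set.mem_ofPred_eq, IsRoot, q, eval_finsetSum, eval_mul, eval_C, eval_pow, eval_X]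
      rw [← h1]
      refine Finset.sum_congr rfl fun j _ => ?_
      have : p.coeff j * (n : B) ^ j = ((n : k) ^ j) • p.coeff j := by
        rw [Algebra.smul_def]; simp [mul_comm]
      rw [this, map_smul, smul_eq_mul, mul_comm]
    · exact Set.infinite_range_of_injective Nat.cast_injective
  by_cases hi : i ≤ p.natDegree
  · have := congrArg (fun r => coeff r i) hq
    simpa [q, coeff_C_mul, coeff_X_pow, hi, Nat.lt_succ_iff] using this
  · rw [coeff_eq_zero_of_natDegree_lt (by omega), map_zero]

lemma poly_ext (k : Type) [Field k] [CharZero k] {B : Type} [CommRing B] [Algebra k B]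
    (p q : B[X]) (h : ∀ n : ℕ, p.eval (n : B) = q.eval (n : B)) : p = q := by
  rw [← sub_eq_zero]
  apply poly_zero k
  intro n
  rw [eval_sub, h, sub_self]
end uniq

section psi
variable {k : Type} [Field k] {H : Type} [CommRing H] [HopfAlgebra k H]

/-- the convolution powers of the identity. -/
noncomputable def ps (k : Type) [Field k] {H : Type} [CommRing H] [HopfAlgebra k H] (n : ℕ) :
    H →ₐ[k] H := ((toConv (AlgHom.id k H)) ^ n).ofConv

lemma ps_lin (n : ℕ) : toConv (ps k (H := H) n).toLinearMap = (toConv LinearMap.id) ^ n := by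
  rw [ps, AlgHom.toLinearMap_convPow]; rfl

lemma ps_zero (x : H) : ps k 0 x = algebraMap k H (counit x) := by
  simp [ps]

lemma ps_one (x : H) : ps k 1 x = x := by
  simp [ps]

lemma ps_add (m n : ℕ) {x : H} {ι : Type} (r : Coalgebra.Repr k x ι) :
    ps k (m + n) x = ∑ i ∈ r.index, ps k m (r.left i) * ps k n (r.right i) := by
  have h : toConv (ps k (H := H) (m+n)).toLinearMap
      = toConv (ps k (H := H) m).toLinearMap * toConv (ps k (H := H) n).toLinearMap := by
    rw [ps_lin, ps_lin, ps_lin, pow_add]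
  have := congrArg (fun f => f.ofConv x) h
  simp only [r.convMul_apply] at this
  exact this

lemma ps_comul [IsCocomm k H] (n : ℕ) {x : H} {ι : Type} (r : Coalgebra.Repr k x ι) :
    comul (R := k) (ps k n x) = ∑ i ∈ r.index, ps k n (r.left i) ⊗ₜ[k] ps k n (r.right i) := by
  let f : H →ₐc[k] H := ((toConv (BialgHom.id k H)) ^ n).ofConv
  have hf : (f : H →ₐ[k] H) = ps k n := by
    have := BialgHom.toAlgHom_convPow (toConv (BialgHom.id k H)) n
    exact congrArg WithConv.ofConv this
  have hf' : ∀ y, ps k n y = f y := fun y => by rw [← hf]; rfl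
  simp only [hf']
  have := CoalgHomClass.map_comp_comul_apply f x
  rw [← this, ← r.eq]
  simp

lemma ps_prim (n : ℕ) {x : H} (hx : x ∈ Primitives k H) : ps k n x = (n : H) * x := by
  have hx' : comul (R := k) x = x ⊗ₜ[k] (1 : H) + (1 : H) ⊗ₜ[k] x := hx
  have h0 : algebraMap k H (counit (R := k) x) = 0 := by
    have := rTensor_counit_comul (R := k) x
    rw [hx'] at this
    simp only [map_add, LinearMap.rTensor_tmul, Bialgebra.counit_one] at this
    have h2 := congrArg (TensorProduct.lid k H) this
    simpa [Algebra.algebraMap_eq_smul_one] using h2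
  induction n with
  | zero => rw [ps_zero, h0]; simp
  | succ n ih =>
    let r : Coalgebra.Repr k x Bool :=
      { index := Finset.univ, left := fun b => if b then x else 1,
        right := fun b => if b then 1 else x, eq := by simp [hx'] }
    rw [ps_add n 1 r]
    simp [r, ih, ps_one]
    ring

/-- All curves `n ↦ ps n x` are polynomial. -/
def HasPoly (k : Type) [Field k] (H : Type) [CommRing H] [HopfAlgebra k H] : Prop :=
  ∀ x : H, ∃ p : H[X], ∀ n : ℕ, p.eval (n : H) = ps k n x

variable [CharZero k]

/-- The polynomial. -/
noncomputable def Psi (h : HasPoly k H) : H →ₗ[k] H[X] where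
  toFun x := (h x).choose
  map_add' x y := by
    apply poly_ext k
    intro n
    rw [eval_add, (h x).choose_spec, (h y).choose_spec, (h (x + y)).choose_spec, map_add]
  map_smul' c x := by
    apply poly_ext k
    intro n
    rw [(h (c • x)).choose_spec, map_smul, RingHom.id_apply, eval_smul, (h x).choose_spec]

variable (h : HasPoly k H)

lemma Psi_eval (x : H) (n : ℕ) : (Psi h x).eval (n : H) = ps k n x := (h x).choose_spec n

lemma Psi_mul (x y : H) : Psi h (x * y) = Psi h x * Psi h y := by
  apply poly_ext k
  intro n
  rw [eval_mul, Psi_eval, Psi_eval, Psi_eval, map_mul]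

lemma Psi_algebraMap (c : k) : Psi h (algebraMap k H c) = C (algebraMap k H c) := by
  apply poly_ext k
  intro n
  rw [eval_C, Psi_eval, AlgHom.commutes]

lemma Psi_prim {x : H} (hx : x ∈ Primitives k H) : Psi h x = X * C x := by
  apply poly_ext k
  intro n
  rw [Psi_eval, ps_prim n hx, eval_mul, eval_X, eval_C]

lemma Psi_coeff_zero (x : H) : (Psi h x).coeff 0 = algebraMap k H (counit x) := by
  rw [coeff_zero_eq_eval_zero, ← ps_zero, ← Psi_eval h]; simp

/-- The first Eulerian idempotent. -/
noncomputable def ee : H →ₗ[k] H where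
  toFun x := (Psi h x).coeff 1
  map_add' x y := by simp
  map_smul' c x := by simp

lemma ee_def (x : H) : ee h x = (Psi h x).coeff 1 := rfl

lemma Psi_deriv {x : H} {ι : Type} (r : Coalgebra.Repr k x ι) :
    derivative (Psi h x) = ∑ i ∈ r.index, C (ee h (r.left i)) * Psi h (r.right i) := by
  apply poly_ext k
  intro m
  have h1 : (Psi h x).comp (X + C (m : H)) =
      ∑ i ∈ r.index, Psi h (r.left i) * C (ps k m (r.right i)) := by
    apply poly_ext k
    intro n
    have := Psi_eval h x (n + m)
    rw [ps_add n m r] at this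
    simp only [eval_comp, eval_add, eval_X, eval_C, eval_finsetSum, eval_mul, Psi_eval]
    rw [← this]; simp
  have h2 := congrArg (fun p => (derivative p).eval 0) h1
  simp only [derivative_comp, derivative_sum, eval_finsetSum, derivative_mul, eval_mul, eval_comp,
    derivative_C, eval_add, eval_C, eval_X, derivative_add, derivative_X, zero_add, one_mul,
    mul_zero, add_zero, eval_zero, eval_one] at h2
  rw [h2]
  simp only [eval_finsetSum, eval_mul, eval_C, Psi_eval, ee_def]
  refine Finset.sum_congr rfl fun i _ => ?_
  rw [← coeff_zero_eq_eval_zero, coeff_derivative]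
  simp

lemma Psi_coeff_succ {x : H} {ι : Type} (r : Coalgebra.Repr k x ι) (j : ℕ) :
    ((j : k) + 1) • (Psi h x).coeff (j + 1)
      = ∑ i ∈ r.index, ee h (r.left i) * (Psi h (r.right i)).coeff j := by
  have := congrArg (fun p => coeff p j) (Psi_deriv h r)
  simp only [coeff_derivative, finsetSum_coeff, coeff_C_mul] at this
  rw [← this, Algebra.smul_def]
  simp [mul_comm]

lemma ee_prim [IsCocomm k H] (x : H) : ee h x ∈ Primitives k H := by
  let r := Coalgebra.Repr.arbitrary k x
  let i₁ : H →ₐ[k] H ⊗[k] H := Algebra.TensorProduct.includeLeft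
  let i₂ : H →ₐ[k] H ⊗[k] H := Algebra.TensorProduct.includeRight
  have key : (Psi h x).map (Bialgebra.comulAlgHom k H).toRingHom =
      ∑ i ∈ r.index, (Psi h (r.left i)).map i₁.toRingHom * (Psi h (r.right i)).map i₂.toRingHom := by
    apply poly_ext k
    intro n
    have ev : ∀ (f : H →ₐ[k] H ⊗[k] H) (p : H[X]),
        (p.map f.toRingHom).eval (n : H ⊗[k] H) = f (p.eval (n : H)) := by
      intro f p
      have := Polynomial.eval_natCast_map f.toRingHom p n
      exact this
    simp only [eval_finsetSum, eval_mul, ev, Psi_eval]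
    rw [Bialgebra.comulAlgHom_apply, ps_comul n r]
    simp [i₁, i₂]
  have h1 := congrArg (fun p => coeff p 1) key
  simp only [coeff_map, finsetSum_coeff, coeff_mul, Finset.Nat.antidiagonal_succ,
    Finset.Nat.antidiagonal_zero, Finset.sum_cons, Finset.map_singleton, Finset.sum_singleton,
    Function.Embedding.prodMap, Psi_coeff_zero] at h1
  simp [Psi_coeff_zero, ← ee_def, i₁, i₂] at h1
  have a1 : ∑ i ∈ r.index, counit (R := k) (r.left i) • r.right i = x := sum_counit_smul r
  have a2 : ∑ i ∈ r.index, counit (R := k) (r.right i) • r.left i = x := by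
    have := sum_tmul_counit_eq r
    have h2 := congrArg (TensorProduct.rid k H) this
    simp only [map_sum, TensorProduct.rid_tmul, one_smul] at h2
    exact h2
  have b1 := congrArg (fun y => (1 : H) ⊗ₜ[k] ee h y) a1
  have b2 := congrArg (fun y => ee h y ⊗ₜ[k] (1 : H)) a2
  simp only [map_sum, map_smul, TensorProduct.tmul_sum, TensorProduct.sum_tmul] at b1 b2
  change comul (R := k) (ee h x) = _
  rw [← b1, ← b2, h1, ← Finset.sum_add_distrib]
  refine Finset.sum_congr rfl fun i _ => ?_
  simp [Algebra.algebraMap_eq_smul_one, TensorProduct.smul_tmul, add_comm]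

lemma coeff_mem_adjoin [IsCocomm k H] (j : ℕ) : ∀ x : H,
    (Psi h x).coeff j ∈ Algebra.adjoin k ((Primitives k H : Submodule k H) : Set H) := by
  induction j with
  | zero => intro x; rw [Psi_coeff_zero]; exact Subalgebra.algebraMap_mem _ _
  | succ j ih =>
    intro x
    have := Psi_coeff_succ h (Coalgebra.Repr.arbitrary k x) j
    have hj : ((j : k) + 1) ≠ 0 := by exact_mod_cast Nat.succ_ne_zero j
    rw [← inv_smul_smul₀ hj ((Psi h x).coeff (j + 1)), this]
    refine Subalgebra.smul_mem _ (Subalgebra.sum_mem _ fun i _ => ?_) _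
    exact Subalgebra.mul_mem _ (Algebra.subset_adjoin (ee_prim h _)) (ih _)

lemma generated (h : HasPoly k H) [IsCocomm k H] :
    Algebra.adjoin k ((Primitives k H : Submodule k H) : Set H) = ⊤ := by
  rw [eq_top_iff]
  intro x _
  rw [← ps_one (k := k) x, ← Psi_eval h]
  rw [Nat.cast_one, eval_eq_sum_range]
  refine Subalgebra.sum_mem _ fun i _ => ?_
  simpa using coeff_mem_adjoin h i x

lemma hasPoly_of_adjoin (s : Set H) (hs : s ⊆ Primitives k H) (ht : Algebra.adjoin k s = ⊤) :
    HasPoly k H := by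
  intro x
  have hx : x ∈ Algebra.adjoin k s := by rw [ht]; trivial
  induction hx using Algebra.adjoin_induction with
  | mem x hx => exact ⟨X * C x, fun n => by rw [ps_prim n (hs hx), eval_mul, eval_X, eval_C]⟩
  | algebraMap c => exact ⟨C (algebraMap k H c), fun n => by rw [eval_C, AlgHom.commutes]⟩
  | add x y _ _ hx hy =>
    obtain ⟨p, hp⟩ := hx
    obtain ⟨q, hq⟩ := hy
    exact ⟨p + q, fun n => by rw [eval_add, hp, hq, map_add]⟩
  | mul x y _ _ hx hy =>
    obtain ⟨p, hp⟩ := hx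
    obtain ⟨q, hq⟩ := hy
    exact ⟨p * q, fun n => by rw [eval_mul, hp, hq, map_mul]⟩

lemma ee_mem_of_adjoin (V : Submodule k H) (hs : V ≤ Primitives k H)
    (ht : Algebra.adjoin k (V : Set H) = ⊤) (x : H) : ee h x ∈ V := by
  have hx : x ∈ Algebra.adjoin k (V : Set H) := by rw [ht]; trivial
  induction hx using Algebra.adjoin_induction with
  | mem x hx => rw [ee_def, Psi_prim h (hs hx)]; simpa using hx
  | algebraMap c => rw [ee_def, Psi_algebraMap, coeff_C]; simp
  | add x y _ _ hx hy => rw [map_add]; exact V.add_mem hx hy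
  | mul x y _ _ hx hy =>
    rw [ee_def, Psi_mul, mul_coeff_one, Psi_coeff_zero, Psi_coeff_zero, mul_comm _ (algebraMap k H _),
      ← Algebra.smul_def, ← Algebra.smul_def]
    exact V.add_mem (V.smul_mem _ hy) (V.smul_mem _ hx)
end psi

section conil
variable {k : Type} [Field k] {H : Type} [CommRing H] [HopfAlgebra k H]

lemma J_factor (f : WithConv (H →ₗ[k] H)) (hf : f.ofConv ∘ₗ piAug (k := k) = f.ofConv) (n : ℕ) :
    ∃ L : (TpowM (ModuleCat.of k H) n) →ₗ[k] H,
      ((toConv (piAug (k := k) (H := H))) ^ n * f).ofConv = L ∘ₗ piPow n ∘ₗ iterComul n := by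
  induction n with
  | zero => exact ⟨f.ofConv, by rw [pow_zero, one_mul]; exact hf.symm⟩
  | succ n ih =>
    obtain ⟨L, hL⟩ := ih
    refine ⟨LinearMap.mul' k H ∘ₗ LinearMap.lTensor H L, ?_⟩
    rw [pow_succ', mul_assoc, LinearMap.convMul_def, hL]
    change _ = (LinearMap.mul' k H ∘ₗ LinearMap.lTensor H L) ∘ₗ
      (TensorProduct.map (piAug : H →ₗ[k] H) (piPow n)) ∘ₗ
      ((LinearMap.lTensor H (iterComul n)).comp (Coalgebra.comul (R := k) (A := H)))
    simp only [LinearMap.lTensor, ← LinearMap.comp_assoc, ← TensorProduct.map_comp]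
    simp only [LinearMap.comp_assoc, ← TensorProduct.map_comp]
    rfl

lemma J_one (n : ℕ) : ((toConv (piAug (k := k) (H := H))) ^ (n + 1)).ofConv 1 = 0 := by
  rw [pow_succ', LinearMap.convMul_apply, Bialgebra.comul_one, Algebra.TensorProduct.one_def]
  simp [piAug]

lemma J_comp (n : ℕ) : ((toConv (piAug (k := k) (H := H))) ^ (n + 1)).ofConv ∘ₗ piAug (k := k)
    = ((toConv (piAug (k := k) (H := H))) ^ (n + 1)).ofConv := by
  ext x
  have : piAug (k := k) x = x - counit (R := k) x • (1 : H) := by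
    simp [piAug, Algebra.algebraMap_eq_smul_one]
  rw [LinearMap.comp_apply, this, map_sub, map_smul, J_one]
  simp

lemma J_nil (hconil : IsConilpotent k H) (x : H) :
    ∃ N : ℕ, ∀ n, N ≤ n → ((toConv (piAug (k := k) (H := H))) ^ n).ofConv x = 0 := by
  obtain ⟨n, hn⟩ := hconil x
  refine ⟨n + 1, fun m hm => ?_⟩
  obtain ⟨d, rfl⟩ := Nat.exists_eq_add_of_le hm
  obtain ⟨L, hL⟩ := J_factor _ (J_comp (k := k) (H := H) d) n
  rw [show n + 1 + d = n + (d + 1) by ring, pow_add, hL]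
  simp [hn]

lemma hasPoly_of_conil [CharZero k] (hconil : IsConilpotent k H) : HasPoly k H := by
  intro x
  obtain ⟨N, hN⟩ := J_nil hconil x
  let J := toConv (piAug (k := k) (H := H))
  refine ⟨∑ j ∈ Finset.range N, C (((j.factorial : k)⁻¹) • (J ^ j).ofConv x) * descPochhammer H j, ?_⟩
  intro n
  have hid : toConv (LinearMap.id (R := k) (M := H)) = J + 1 := by
    apply WithConv.ext
    ext y
    simp [J, piAug, LinearMap.convOne_def]
  have h1 : ps k n x = ((J + 1) ^ n).ofConv x := by
    rw [← hid, ← ps_lin]; rfl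
  have h2 : ∀ M, n + 1 ≤ M → ps k n x = ∑ j ∈ Finset.range M, (n.choose j) • (J ^ j).ofConv x := by
    intro M hM
    rw [h1, (Commute.one_right J).add_pow]
    rw [ofConv_sum, LinearMap.sum_apply]
    rw [← Finset.sum_subset (Finset.range_mono hM)]
    · refine Finset.sum_congr rfl fun j _ => ?_
      rw [one_pow, mul_one, ← nsmul_eq_mul']
      exact congrArg (fun f : H →ₗ[k] H => f x) (map_nsmul (WithConv.addEquiv (H →ₗ[k] H)) (n.choose j) (J ^ j))
    · intro j _ hj
      rw [Nat.choose_eq_zero_of_lt (by simpa using hj), zero_smul]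
  rw [h2 (n + 1 + N) (by omega), ← Finset.sum_subset (Finset.range_mono (show N ≤ n + 1 + N by omega))]
  · rw [eval_finsetSum]
    refine Finset.sum_congr rfl fun j _ => ?_
    rw [eval_mul, eval_C, descPochhammer_eval_eq_descFactorial, Nat.descFactorial_eq_factorial_mul_choose]
    have hj : (j.factorial : k) ≠ 0 := by exact_mod_cast j.factorial_ne_zero
    have : ((j.factorial * n.choose j : ℕ) : H) = algebraMap k H (j.factorial * n.choose j) := by simp
    rw [this, mul_comm, ← Algebra.smul_def, smul_smul, mul_right_comm, mul_inv_cancel₀ hj, one_mul]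
    exact Nat.cast_smul_eq_nsmul k _ _
  · intro j _ hj
    rw [hN j (by simpa using hj), smul_zero]
end conil

section inj
variable {k : Type} [Field k] [CharZero k] {H : Type} [CommRing H] [HopfAlgebra k H]
  {S : Type} [CommRing S] [HopfAlgebra k S]

/-- The recursively defined components of the inverse. -/
noncomputable def hh (e : H →ₗ[k] S) : ℕ → (H →ₗ[k] S)
  | 0 => Algebra.linearMap k S ∘ₗ counit
  | j + 1 => ((j : k) + 1)⁻¹ • (LinearMap.mul' k S ∘ₗ TensorProduct.map e (hh e j) ∘ₗ comul)

lemma ps_bialg (g : S →ₐc[k] H) (n : ℕ) (s : S) : g (ps k n s) = ps k n (g s) := by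
  induction n generalizing s with
  | zero => rw [ps_zero, ps_zero, AlgHomClass.commutes, CoalgHomClass.counit_comp_apply]
  | succ n ih =>
    let r := Coalgebra.Repr.arbitrary k s
    rw [ps_add n 1 r, ps_add n 1 (r.induced g)]
    simp [ih, ps_one]

lemma Psi_bialg (hH : HasPoly k H) (hS : HasPoly k S) (g : S →ₐc[k] H) (s : S) :
    Psi hH (g s) = (Psi hS s).map (g : S →ₐ[k] H).toRingHom := by
  apply poly_ext k
  intro n
  rw [Psi_eval, Polynomial.eval_natCast_map, Psi_eval]
  exact (ps_bialg g n s).symm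

lemma inj (hH : HasPoly k H) (hS : HasPoly k S) (g : S →ₐc[k] H) (e : H →ₗ[k] S)
    (he : ∀ s, e (g s) = ee hS s) : Function.Injective g := by
  have key : ∀ j s, hh e j (g s) = (Psi hS s).coeff j := by
    intro j
    induction j with
    | zero => intro s; simp [hh, Psi_coeff_zero]
    | succ j ih =>
      intro s
      have hj : ((j : k) + 1) ≠ 0 := by exact_mod_cast Nat.succ_ne_zero j
      rw [← inv_smul_smul₀ hj ((Psi hS s).coeff (j + 1)),
        Psi_coeff_succ hS (Coalgebra.Repr.arbitrary k s)]
      simp only [hh, LinearMap.smul_apply, LinearMap.comp_apply]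
      congr 1
      rw [← ((Coalgebra.Repr.arbitrary k s).induced g).eq]
      simp [he, ih]
  rw [injective_iff_map_eq_zero]
  intro s hs
  rw [← ps_one (k := k) s, ← Psi_eval hS]
  have : Psi hS s = 0 := by
    ext j
    rw [← key, hs]; simp
  simp [this]
end inj
end MM

/-- **Milnor–Moore in characteristic zero.** A conilpotent commutative and
cocommutative Hopf algebra `H` over a field of characteristic `0` is generated by its
primitives, and the canonical algebra map `Sym(P(H)) → H` (induced by the inclusion of the
primitives via the universal property of the symmetric algebra) is an isomorphism of Hopf
algebras, where `Sym(P(H))` carries the Hopf structure in which `P(H)` is primitive. -/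
theorem milnor_moore_char_zero (k : Type) [Field k] [CharZero k]
    (H : Type) [CommRing H] [HopfAlgebra k H]
    (hcocomm : (TensorProduct.comm k H H).toLinearMap ∘ₗ Coalgebra.comul (R := k) =
      (Coalgebra.comul : H →ₗ[k] H ⊗[k] H))
    (hconil : IsConilpotent k H)
    (S : Type) [CommRing S] [HopfAlgebra k S]
    (ι : (Primitives k H) →ₗ[k] S)
    (hS : IsSymAlg k ι)
    (hSprim : ∀ v : Primitives k H, (ι v) ∈ Primitives k S) :
    Algebra.adjoin k ((Primitives k H : Submodule k H) : Set H) = ⊤ ∧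
    ∃ g : S →ₐ[k] H,
      (∀ v : Primitives k H, g (ι v) = (v : H)) ∧
      Function.Bijective g ∧
      (TensorProduct.map g.toLinearMap g.toLinearMap ∘ₗ Coalgebra.comul (R := k) =
        Coalgebra.comul (R := k) ∘ₗ g.toLinearMap) ∧
      (Coalgebra.counit (R := k) ∘ₗ g.toLinearMap = Coalgebra.counit (R := k) (A := S)) := by
  haveI : Coalgebra.IsCocomm k H := ⟨hcocomm⟩
  have hH : MM.HasPoly k H := MM.hasPoly_of_conil hconil
  have hgen := MM.generated hH
  refine ⟨hgen, ?_⟩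
  obtain ⟨g, hg, -⟩ := hS H (Primitives k H).subtype
  have hg' : ∀ v : Primitives k H, g (ι v) = (v : H) := hg
  have hV : Algebra.adjoin k ((LinearMap.range ι : Submodule k S) : Set S) = ⊤ := by
    let A := Algebra.adjoin k ((LinearMap.range ι : Submodule k S) : Set S)
    obtain ⟨q, hq, -⟩ := hS A (ι.codRestrict A.toSubmodule
      (fun v => Algebra.subset_adjoin ⟨v, rfl⟩))
    have : A.val.comp q = AlgHom.id k S := by
      refine (hS S ι).unique (fun v => ?_) (fun v => rfl)
      rw [AlgHom.comp_apply, hq]; rfl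
    rw [eq_top_iff]
    intro s _
    have h1 := DFunLike.congr_fun this s
    rw [AlgHom.comp_apply, AlgHom.id_apply] at h1
    rw [← h1]
    exact (q s).2
  have hcounit0 : ∀ (B : Type) [CommRing B] [HopfAlgebra k B] (x : B), x ∈ Primitives k B →
      Coalgebra.counit (R := k) x = 0 := by
    intro B _ _ x hx
    have hx' : Coalgebra.comul (R := k) x = x ⊗ₜ[k] (1 : B) + (1 : B) ⊗ₜ[k] x := hx
    have := Coalgebra.rTensor_counit_comul (R := k) x
    rw [hx'] at this
    simp only [map_add, LinearMap.rTensor_tmul, Bialgebra.counit_one] at this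
    have h2 := congrArg (Coalgebra.counit (R := k) ∘ₗ (TensorProduct.lid k B).toLinearMap) this
    simpa using h2
  have hcomul : (Algebra.TensorProduct.map g g).comp (Bialgebra.comulAlgHom k S) =
      (Bialgebra.comulAlgHom k H).comp g := by
    refine (hS (H ⊗[k] H) ((Bialgebra.comulAlgHom k H).toLinearMap ∘ₗ
      (Primitives k H).subtype)).unique (fun v => ?_) (fun v => ?_)
    · have h1 : Coalgebra.comul (R := k) (ι v) = ι v ⊗ₜ[k] (1 : S) + (1 : S) ⊗ₜ[k] ι v := hSprim v
      have h2 : Coalgebra.comul (R := k) (v : H) = (v : H) ⊗ₜ[k] (1 : H) + (1 : H) ⊗ₜ[k] (v : H) := v.2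
      simp [h1, h2, hg']
    · simp [hg']
  have hcounit : (Bialgebra.counitAlgHom k H).comp g = Bialgebra.counitAlgHom k S := by
    refine (hS k 0).unique (fun v => ?_) (fun v => ?_)
    · simp [hg', hcounit0 H v v.2]
    · simp [hcounit0 S _ (hSprim v)]
  let G : S →ₐc[k] H := BialgHom.ofAlgHom g hcounit hcomul
  have hG : ∀ s, G s = g s := fun s => rfl
  have hle : LinearMap.range ι ≤ Primitives k S := by
    rintro _ ⟨v, rfl⟩; exact hSprim v
  have hSp : MM.HasPoly k S := MM.hasPoly_of_adjoin _ hle hV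
  refine ⟨g, hg', ⟨?_, ?_⟩, ?_, ?_⟩
  · have := MM.inj hH hSp G (ι ∘ₗ (MM.ee hH).codRestrict _ (fun x => MM.ee_prim hH x)) ?_
    · exact this
    · intro s
      obtain ⟨v, hv⟩ := MM.ee_mem_of_adjoin hSp _ hle hV s
      rw [← hv, LinearMap.comp_apply]
      congr 1
      apply Subtype.ext
      rw [LinearMap.codRestrict_apply, MM.ee_def, MM.Psi_bialg hH hSp G s, Polynomial.coeff_map,
        ← MM.ee_def, ← hv]
      exact hg' v
  · rw [← AlgHom.range_eq_top, eq_top_iff, ← hgen]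
    apply Algebra.adjoin_le
    intro v hv
    exact ⟨ι ⟨v, hv⟩, hg' ⟨v, hv⟩⟩
  · exact congrArg AlgHom.toLinearMap hcomul
  · exact congrArg AlgHom.toLinearMap hcounit
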